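/- Let (X,Φ) and (Y,Ψ) be regular topological flows which are orbit equivalent via a homeomorphism Λ : X → Y. If (X,Φ) has the small flow boundary property, then (Y,Ψ) has the small flow boundary property. In particular, the small flow boundary property is preserved by orbit equivalence for regular topological flows. -/

import Mathlib

open Set Filter Topology MeasureTheory

namespace FlowPaper

variable {X : Type*} [MetricSpace X]

/-- The flow `Φ` is regular when no point is fixed by the whole flow. -/
def Regular (Φ : Flow ℝ X) : Prop := ∀ x : X, ∃ t : ℝ, Φ t x ≠ x

/-- `φ_I(E) = {φ_t x : t ∈ I, x ∈ E}`. -/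
def flowSet (Φ : Flow ℝ X) (I : Set ℝ) (E : Set X) : Set X := ⋃ t ∈ I, Φ t '' E

/-- The `ζ`-cylinder `S_ζ = φ_{[-ζ,ζ]}(S)`. -/
def cyl (Φ : Flow ℝ X) (S : Set X) (ζ : ℝ) : Set X := flowSet Φ (Icc (-ζ) ζ) S

/-- `S` is a cross-section of time `η` if `Φ` is injective on `S × [-η,η]`. -/
def IsCrossSection (Φ : Flow ℝ X) (S : Set X) (η : ℝ) : Prop :=
  Set.InjOn (fun p : X × ℝ => Φ p.2 p.1) (S ×ˢ Icc (-η) η)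

/-- Weakly extendable cross-section of time `η`. -/
def IsWec (Φ : Flow ℝ X) (S : Set X) (η : ℝ) : Prop :=
  IsCrossSection Φ S η ∧ IsCrossSection Φ (closure S) η

/-- The flow interior `Int^Φ(S) = Int(S_η) ∩ S`. -/
def flowInterior (Φ : Flow ℝ X) (S : Set X) (η : ℝ) : Set X := interior (cyl Φ S η) ∩ S

/-- The flow boundary `∂^Φ S = closure S \ Int^Φ(S)`. -/
def flowBoundary (Φ : Flow ℝ X) (S : Set X) (η : ℝ) : Set X := closure S \ flowInterior Φ S η

/-- `∂^Φ S_ζ = φ_{[-ζ,ζ]}(∂^Φ S)`. -/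
def flowBoundaryCyl (Φ : Flow ℝ X) (S : Set X) (η ζ : ℝ) : Set X := cyl Φ (flowBoundary Φ S η) ζ

/-- A cross-section is global when some cylinder covers `X`. -/
def IsGlobal (Φ : Flow ℝ X) (S : Set X) : Prop := ∃ ξ > 0, cyl Φ S ξ = univ

/-- First return time `t_S(x) = inf {t > 0 : φ_t x ∈ S}`. -/
noncomputable def returnTime (Φ : Flow ℝ X) (S : Set X) (x : X) : ℝ :=
  sInf {t : ℝ | 0 < t ∧ Φ t x ∈ S}

/-- First return map `T_S(x) = φ_{t_S(x)}(x)`. -/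
noncomputable def returnMap (Φ : Flow ℝ X) (S : Set X) (x : X) : X := Φ (returnTime Φ S x) x

/-- A measure is `Φ`-invariant when it is invariant under every time `t`-map. -/
def FlowInvariant [MeasurableSpace X] (Φ : Flow ℝ X) (μ : Measure X) : Prop :=
  ∀ t : ℝ, Measure.map (Φ t) μ = μ

/-- A w.e.c. `S` of time `η` has small flow boundary when `∂^Φ S_η` is a null set. -/
def HasSmallFlowBoundary [MeasurableSpace X] (Φ : Flow ℝ X) (S : Set X) (η : ℝ) : Prop :=
  ∀ μ : Measure X, IsProbabilityMeasure μ → FlowInvariant Φ μ → μ (flowBoundaryCyl Φ S η η) = 0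

/-- The small flow boundary property of a flow. -/
def SmallFlowBoundaryProperty [MeasurableSpace X] (Φ : Flow ℝ X) : Prop :=
  ∀ x : X, ∀ S' : Set X, ∀ η : ℝ, 0 < η → IsWec Φ S' η → x ∈ flowInterior Φ S' η →
    ∃ S ⊆ S', x ∈ flowInterior Φ S η ∧ IsWec Φ S η ∧ HasSmallFlowBoundary Φ S η

/-- The frontier of `A` with respect to the topology induced on `B`. -/
def frontierIn (B A : Set X) : Set X :=
  Subtype.val '' (frontier (Subtype.val ⁻¹' A : Set B))

/-- Orbit equivalence of two topological flows via a homeomorphism `Λ`: for each `x` there is a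
continuous strictly increasing surjective time-reparametrization `α x : ℝ → ℝ` fixing `0` such
that `Λ` intertwines the orbits. This maps every `Φ`-orbit onto a `Ψ`-orbit preserving the
orientation of orbits. -/
def OrbitEquivalence {Y : Type*} [MetricSpace Y] (Φ : Flow ℝ X) (Ψ : Flow ℝ Y) (Λ : X ≃ₜ Y) :
    Prop :=
  ∃ α : X → ℝ → ℝ, ∀ x : X,
    StrictMono (α x) ∧ Continuous (α x) ∧ Function.Surjective (α x) ∧ α x 0 = 0 ∧
    ∀ t : ℝ, Λ (Φ t x) = Ψ (α x t) (Λ x)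

section CrossSections

lemma mem_cyl {Φ : Flow ℝ X} {S : Set X} {ζ : ℝ} {x : X} :
    x ∈ cyl Φ S ζ ↔ ∃ t ∈ Icc (-ζ) ζ, ∃ z ∈ S, Φ t z = x := by
  simp only [cyl, flowSet, mem_iUnion, mem_image, exists_prop]

lemma isCompact_flowSet (Φ : Flow ℝ X) {I : Set ℝ} {E : Set X} (hI : IsCompact I)
    (hE : IsCompact E) : IsCompact (flowSet Φ I E) := by
  have h : flowSet Φ I E = (fun p : ℝ × X => Φ p.1 p.2) '' (I ×ˢ E) := by
    ext x
    simp only [flowSet, mem_iUnion, mem_image, exists_prop, mem_prod, Prod.exists]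
    constructor
    · rintro ⟨t, ht, z, hz, rfl⟩
      exact ⟨t, z, ⟨ht, hz⟩, rfl⟩
    · rintro ⟨t, z, ⟨ht, hz⟩, rfl⟩
      exact ⟨t, ht, z, hz, rfl⟩
  rw [h]
  exact (hI.prod hE).image (by fun_prop)

lemma IsCrossSection.mono {Φ : Flow ℝ X} {S T : Set X} {η : ℝ} (hT : IsCrossSection Φ T η)
    (h : S ⊆ T) : IsCrossSection Φ S η :=
  InjOn.mono (prod_mono h subset_rfl) hT

lemma IsCrossSection.eq_of_flow_eq {Φ : Flow ℝ X} {S : Set X} {η : ℝ} (h : IsCrossSection Φ S η)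
    {z w : X} {s t : ℝ} (hz : z ∈ S) (hw : w ∈ S) (hs : s ∈ Icc (-η) η) (ht : t ∈ Icc (-η) η)
    (e : Φ s z = Φ t w) : z = w ∧ s = t := by
  simpa using h (x₁ := (z, s)) ⟨hz, hs⟩ (x₂ := (w, t)) ⟨hw, ht⟩ e

lemma IsCrossSection.flow_ne {Φ : Flow ℝ X} {S : Set X} {η : ℝ} (hη : 0 < η)
    (h : IsCrossSection Φ S η) {z : X} (hz : z ∈ S) : Φ η z ≠ z := by
  intro e
  have := (h.eq_of_flow_eq hz hz (s := η) (t := 0) ⟨by linarith, le_rfl⟩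
    ⟨by linarith, hη.le⟩ (by rw [e, Φ.map_zero_apply])).2
  linarith

/-- Two visits of an orbit to a cross-section of time `η` are more than `2 * η` apart. -/
lemma IsCrossSection.visit_unique {Φ : Flow ℝ X} {S : Set X} {η : ℝ} (h : IsCrossSection Φ S η)
    {x : X} {u v : ℝ} (hu : Φ u x ∈ S) (hv : Φ v x ∈ S) (huv : |u - v| ≤ 2 * η) : u = v := by
  rw [abs_le] at huv
  have := (h.eq_of_flow_eq hu hv (s := (v - u) / 2) (t := (u - v) / 2)
    ⟨by linarith, by linarith⟩ ⟨by linarith, by linarith⟩ (by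
      rw [← Φ.map_add, ← Φ.map_add]; congr 1; ring)).2
  linarith

/-- The flow interior may be computed with a thinner cylinder. -/
lemma flowInterior_subset_interior_cyl [CompactSpace X] {Φ : Flow ℝ X} {S : Set X} {η ζ : ℝ}
    (hS : IsWec Φ S η) (hζ : 0 < ζ) (hζη : ζ ≤ η) :
    flowInterior Φ S η ⊆ interior (cyl Φ S ζ) := by
  rintro x ⟨hx, hxS⟩
  have hcl : IsCompact (closure S) := isClosed_closure.isCompact
  have hK : IsClosed (flowSet Φ (Icc (-η) (-ζ) ∪ Icc ζ η) (closure S)) :=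
    (isCompact_flowSet Φ (isCompact_Icc.union isCompact_Icc) hcl).isClosed
  have hxK : x ∉ flowSet Φ (Icc (-η) (-ζ) ∪ Icc ζ η) (closure S) := by
    simp only [flowSet, mem_iUnion, mem_image, exists_prop, not_exists, not_and]
    intro t ht z hz e
    have ht' : t ∈ Icc (-η) η := by
      rcases ht with ht | ht
      · exact ⟨ht.1, by linarith [ht.2]⟩
      · exact ⟨by linarith [ht.1], ht.2⟩
    have := (hS.2.eq_of_flow_eq hz (subset_closure hxS) ht' (t := 0)
      ⟨by linarith, by linarith⟩ (by rw [e, Φ.map_zero_apply])).2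
    subst this
    rcases ht with ht | ht
    · linarith [ht.2]
    · linarith [ht.1]
  rw [mem_interior_iff_mem_nhds]
  filter_upwards [mem_interior_iff_mem_nhds.1 hx, hK.isOpen_compl.mem_nhds hxK] with w hw hwK
  obtain ⟨t, ht, z, hz, rfl⟩ := mem_cyl.1 hw
  refine mem_cyl.2 ⟨t, ?_, z, hz, rfl⟩
  by_contra hcon
  apply hwK
  simp only [flowSet, mem_iUnion, mem_image, exists_prop]
  refine ⟨t, ?_, z, subset_closure hz, rfl⟩
  rw [mem_Icc, not_and_or, not_le, not_le] at hcon
  rcases hcon with hcon | hcon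
  · exact Or.inl ⟨ht.1, hcon.le⟩
  · exact Or.inr ⟨hcon.le, ht.2⟩

lemma IsWec.isClosed_flowBoundary {Φ : Flow ℝ X} {S : Set X} {η : ℝ} (hη : 0 < η)
    (hS : IsWec Φ S η) : IsClosed (flowBoundary Φ S η) := by
  have h : flowBoundary Φ S η = closure S \ interior (cyl Φ S η) := by
    ext x
    simp only [flowBoundary, flowInterior, Set.mem_sdiff, mem_inter_iff, not_and]
    refine and_congr_right fun hx => ⟨fun h hi => h hi ?_, fun h hi => absurd hi h⟩
    obtain ⟨t, ht, z, hz, e⟩ := mem_cyl.1 (interior_subset hi)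
    have := (hS.2.eq_of_flow_eq (subset_closure hz) hx ht (t := 0)
      ⟨by linarith, by linarith⟩ (by rw [e, Φ.map_zero_apply])).1
    exact this ▸ hz
  rw [h]
  exact isClosed_closure.sdiff isOpen_interior

end CrossSections

section Reparametrization

variable {Y : Type*} [MetricSpace Y]

/-- `f` is a continuous time change, fixing `0`, of the orbit of `x` onto that of `Λ x`. -/
structure IsTimeChange (Φ : Flow ℝ X) (Ψ : Flow ℝ Y) (Λ : X ≃ₜ Y) (x : X) (f : ℝ → ℝ) :
    Prop where
  continuous : Continuous f
  map_zero : f 0 = 0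
  map_flow : ∀ t, Λ (Φ t x) = Ψ (f t) (Λ x)

lemma IsTimeChange.shift {Φ : Flow ℝ X} {Ψ : Flow ℝ Y} {Λ : X ≃ₜ Y} {x : X} {f : ℝ → ℝ}
    (hf : IsTimeChange Φ Ψ Λ x f) (s : ℝ) :
    IsTimeChange Φ Ψ Λ (Φ s x) (fun t => f (t + s) - f s) where
  continuous := by have := hf.continuous; fun_prop
  map_zero := by simp
  map_flow t := by
    rw [← Φ.map_add, hf.map_flow, hf.map_flow, ← Ψ.map_add, sub_add_cancel]

lemma OrbitEquivalence.symm {Φ : Flow ℝ X} {Ψ : Flow ℝ Y} {Λ : X ≃ₜ Y}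
    (h : OrbitEquivalence Φ Ψ Λ) : OrbitEquivalence Ψ Φ Λ.symm := by
  obtain ⟨α, hα⟩ := h
  have key : ∀ y : Y, ∃ β : ℝ → ℝ, StrictMono β ∧ Continuous β ∧ Function.Surjective β ∧
      β 0 = 0 ∧ ∀ t : ℝ, Λ.symm (Ψ t y) = Φ (β t) (Λ.symm y) := by
    intro y
    obtain ⟨hm, -, hs, h0, hfl⟩ := hα (Λ.symm y)
    let e := hm.orderIsoOfSurjective _ hs
    have he : ∀ t, e t = α (Λ.symm y) t := fun t => rfl
    refine ⟨e.symm, e.symm.strictMono, e.symm.continuous, e.symm.surjective, ?_, fun t => ?_⟩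
    · rw [OrderIso.symm_apply_eq, he, h0]
    · rw [Homeomorph.symm_apply_eq, hfl, ← he, OrderIso.apply_symm_apply, Λ.apply_symm_apply]
  choose β hβ using key
  exact ⟨β, hβ⟩

/-- Near a point which is not fixed by `Ψ c`, time changes stay below `c` for a uniform time. -/
lemma eventually_abs_timeChange_lt (Φ : Flow ℝ X) (Ψ : Flow ℝ Y) (Λ : X ≃ₜ Y) {c : ℝ}
    (hc : 0 < c) {x : X} (hx : Ψ c (Λ x) ≠ Λ x) :
    ∃ δ > 0, ∀ᶠ z in 𝓝 x, ∀ f, IsTimeChange Φ Ψ Λ z f → ∀ t, |t| ≤ δ → |f t| < c := by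
  have hx' : Ψ (-c) (Λ x) ≠ Λ x := by
    intro e
    apply hx
    conv_lhs => rw [← e]
    rw [← Ψ.map_add, add_neg_cancel, Ψ.map_zero_apply]
  have ev : ∀ a : ℝ, Ψ a (Λ x) ≠ Λ x → ∀ᶠ p : ℝ × X in 𝓝 0 ×ˢ 𝓝 x,
      Λ (Φ p.1 p.2) ≠ Ψ a (Λ p.2) := by
    intro a ha
    rw [← nhds_prod_eq]
    have h1 : Continuous fun p : ℝ × X => Λ (Φ p.1 p.2) := by fun_prop
    have h2 : Continuous fun p : ℝ × X => Ψ a (Λ p.2) := by fun_prop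
    refine (isOpen_ne_fun h1 h2).mem_nhds ?_
    simpa [Φ.map_zero_apply] using ha.symm
  have hev := (ev c hx).and (ev (-c) hx')
  obtain ⟨p, hp, q, hq, hpq⟩ := eventually_prod_iff.1 hev
  obtain ⟨δ, hδ, hball⟩ := Metric.nhds_basis_closedBall.eventually_iff.1 hp
  refine ⟨δ, hδ, hq.mono fun z hz f hf t ht => ?_⟩
  have hne : ∀ s, |s| ≤ δ → |f s| ≠ c := by
    intro s hs hfs
    obtain ⟨n1, n2⟩ := hpq (hball (x := s) (by simpa using hs)) hz
    rcases (abs_eq hc.le).1 hfs with e | e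
    · exact n1 (by rw [hf.map_flow, e])
    · exact n2 (by rw [hf.map_flow, e])
  by_contra! hcon
  have hsub : Icc 0 c ⊆ (fun s => |f s|) '' Icc (-δ) δ := by
    have hpc : IsPreconnected ((fun s => |f s|) '' Icc (-δ) δ) :=
      isPreconnected_Icc.image _ (hf.continuous.abs).continuousOn
    refine (Icc_subset_Icc_right hcon).trans (hpc.Icc_subset
      ⟨0, ⟨by linarith, hδ.le⟩, by simp [hf.map_zero]⟩ ⟨t, abs_le.1 ht, rfl⟩)
  obtain ⟨s, hs, e⟩ := hsub ⟨hc.le, le_rfl⟩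
  exact hne s (abs_le.2 hs) e

lemma exists_forall_abs_timeChange_lt (Φ : Flow ℝ X) (Ψ : Flow ℝ Y) (Λ : X ≃ₜ Y) {c : ℝ}
    (hc : 0 < c) {K : Set X} (hK : IsCompact K) (hne : ∀ x ∈ K, Ψ c (Λ x) ≠ Λ x) :
    ∃ δ > 0, ∀ z ∈ K, ∀ f, IsTimeChange Φ Ψ Λ z f → ∀ t, |t| ≤ δ → |f t| < c := by
  refine hK.induction_on
    (p := fun s => ∃ δ > 0, ∀ z ∈ s, ∀ f, IsTimeChange Φ Ψ Λ z f → ∀ t, |t| ≤ δ → |f t| < c)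
    ⟨1, one_pos, by simp⟩ ?_ ?_ ?_
  · rintro s t hst ⟨δ, hδ, h⟩
    exact ⟨δ, hδ, fun z hz => h z (hst hz)⟩
  · rintro s t ⟨δ, hδ, h⟩ ⟨ε, hε, h'⟩
    refine ⟨min δ ε, lt_min hδ hε, ?_⟩
    rintro z (hz | hz) f hf u hu
    · exact h z hz f hf u (hu.trans (min_le_left _ _))
    · exact h' z hz f hf u (hu.trans (min_le_right _ _))
  · intro x hx
    obtain ⟨δ, hδ, h⟩ := eventually_abs_timeChange_lt Φ Ψ Λ hc (hne x hx)
    exact ⟨_, mem_nhdsWithin_of_mem_nhds h, δ, hδ, fun z hz => hz⟩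

lemma Regular.exists_forall_abs_timeChange_lt [CompactSpace X] {Ψ : Flow ℝ Y} (hΨ : Regular Ψ)
    (Φ : Flow ℝ X) (Λ : X ≃ₜ Y) :
    ∃ δ > 0, ∃ C > 0, ∀ z f, IsTimeChange Φ Ψ Λ z f → ∀ t, |t| ≤ δ → |f t| < C := by
  suffices h : ∃ δ > 0, ∃ C > 0, ∀ z ∈ (univ : Set X), ∀ f, IsTimeChange Φ Ψ Λ z f →
      ∀ t, |t| ≤ δ → |f t| < C by simpa using h
  refine isCompact_univ.induction_on
    (p := fun s => ∃ δ > 0, ∃ C > 0, ∀ z ∈ s, ∀ f, IsTimeChange Φ Ψ Λ z f →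
      ∀ t, |t| ≤ δ → |f t| < C)
    ⟨1, one_pos, 1, one_pos, by simp⟩ ?_ ?_ ?_
  · rintro s t hst ⟨δ, hδ, C, hC, h⟩
    exact ⟨δ, hδ, C, hC, fun z hz => h z (hst hz)⟩
  · rintro s t ⟨δ, hδ, C, hC, h⟩ ⟨ε, hε, D, hD, h'⟩
    refine ⟨min δ ε, lt_min hδ hε, max C D, lt_max_of_lt_left hC, ?_⟩
    rintro z (hz | hz) f hf u hu
    · exact lt_max_of_lt_left (h z hz f hf u (hu.trans (min_le_left _ _)))
    · exact lt_max_of_lt_right (h' z hz f hf u (hu.trans (min_le_right _ _)))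
  · intro x _
    obtain ⟨c, hc, hcx⟩ : ∃ c > 0, Ψ c (Λ x) ≠ Λ x := by
      obtain ⟨t, ht⟩ := hΨ (Λ x)
      rcases lt_trichotomy t 0 with h | h | h
      · refine ⟨-t, by linarith, fun e => ht ?_⟩
        conv_lhs => rw [← e]
        rw [← Ψ.map_add, add_neg_cancel, Ψ.map_zero_apply]
      · exact absurd (by rw [h, Ψ.map_zero_apply]) ht
      · exact ⟨t, h, ht⟩
    obtain ⟨δ, hδ, h⟩ := eventually_abs_timeChange_lt Φ Ψ Λ hc hcx
    exact ⟨_, mem_nhdsWithin_of_mem_nhds h, δ, hδ, c, hc, fun z hz => hz⟩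

lemma IsTimeChange.sub_le {Φ : Flow ℝ X} {Ψ : Flow ℝ Y} {Λ : X ≃ₜ Y} {x : X} {f : ℝ → ℝ}
    (hf : IsTimeChange Φ Ψ Λ x f) (hm : Monotone f) {δ C : ℝ} (hδ : 0 < δ) (hC : 0 < C)
    (h : ∀ z f, IsTimeChange Φ Ψ Λ z f → ∀ t, |t| ≤ δ → |f t| < C) {a b : ℝ} (hab : a ≤ b) :
    f b - f a ≤ C * ((b - a) / δ + 1) := by
  have step : ∀ k : ℕ, f (a + k * δ) - f a ≤ k * C := by
    intro k
    induction k with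
    | zero => simp
    | succ k ih =>
      have := h _ _ (hf.shift (a + k * δ)) δ (abs_of_pos hδ).le
      have h2 := (abs_lt.1 this).2
      push_cast
      rw [show a + (k + 1) * δ = δ + (a + k * δ) by ring]
      linarith
  have hk : b ≤ a + ⌈(b - a) / δ⌉₊ * δ := by
    have := (div_le_iff₀ hδ).1 (Nat.le_ceil ((b - a) / δ))
    linarith
  have h1 := step ⌈(b - a) / δ⌉₊
  have h2 := Nat.ceil_lt_add_one (div_nonneg (sub_nonneg.2 hab) hδ.le)
  have h3 := hm hk
  nlinarith

lemma image_flowInterior_subset [CompactSpace X] {Φ : Flow ℝ X} {Ψ : Flow ℝ Y} {Λ : X ≃ₜ Y}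
    (h : OrbitEquivalence Φ Ψ Λ) {T : Set X} {η' η : ℝ} (hη' : 0 < η') (hη : 0 < η)
    (hT : IsWec Φ T η') (hS : IsCrossSection Ψ (closure (Λ '' T)) η) :
    Λ '' flowInterior Φ T η' ⊆ flowInterior Ψ (Λ '' T) η := by
  obtain ⟨α, hα⟩ := h
  obtain ⟨δ, hδ, hδ'⟩ := exists_forall_abs_timeChange_lt Φ Ψ Λ hη
    (isClosed_closure (s := T)).isCompact
    (fun x hx => hS.flow_ne hη (by rw [← Λ.image_closure]; exact mem_image_of_mem _ hx))
  have hsub : Λ '' cyl Φ T (min δ η') ⊆ cyl Ψ (Λ '' T) η := by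
    rintro _ ⟨x, hx, rfl⟩
    obtain ⟨t, ht, z, hz, rfl⟩ := mem_cyl.1 hx
    obtain ⟨-, hc, -, h0, hfl⟩ := hα z
    refine mem_cyl.2 ⟨α z t, abs_le.1 (hδ' z (subset_closure hz) _ ⟨hc, h0, hfl⟩ t ?_).le,
      Λ z, mem_image_of_mem _ hz, (hfl t).symm⟩
    exact (abs_le.2 ht).trans (min_le_left _ _)
  rintro _ ⟨x, hx, rfl⟩
  refine ⟨interior_mono hsub ?_, mem_image_of_mem _ hx.2⟩
  rw [← Λ.image_interior]
  exact mem_image_of_mem _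
    (flowInterior_subset_interior_cyl hT (lt_min hδ hη') (min_le_right _ _) hx)

lemma image_flowInterior [CompactSpace X] [CompactSpace Y] {Φ : Flow ℝ X} {Ψ : Flow ℝ Y}
    {Λ : X ≃ₜ Y} (h : OrbitEquivalence Φ Ψ Λ) {T : Set X} {η' η : ℝ} (hη' : 0 < η')
    (hη : 0 < η) (hT : IsWec Φ T η') (hS : IsWec Ψ (Λ '' T) η) :
    Λ '' flowInterior Φ T η' = flowInterior Ψ (Λ '' T) η := by
  refine (image_flowInterior_subset h hη' hη hT hS.2).antisymm ?_
  have e : Λ.symm '' (Λ '' T) = T := Λ.symm_image_image T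
  have := image_flowInterior_subset h.symm hη hη' hS (by rw [e]; exact hT.2)
  rw [e] at this
  intro y hy
  exact ⟨Λ.symm y, this (mem_image_of_mem _ hy), Λ.apply_symm_apply y⟩

/-- Orbit equivalences carry cross-sections of positive time to cross-sections of positive time. -/
lemma OrbitEquivalence.exists_isWec [CompactSpace X] {Φ : Flow ℝ X} {Ψ : Flow ℝ Y} {Λ : X ≃ₜ Y}
    (h : OrbitEquivalence Φ Ψ Λ) {T : Set X} {η : ℝ} (hη : 0 < η) (hS : IsWec Ψ (Λ '' T) η) :
    ∃ η' > 0, IsWec Φ T η' := by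
  obtain ⟨α, hα⟩ := h
  have hmem : ∀ x ∈ closure T, Λ x ∈ closure (Λ '' T) := fun x hx => by
    rw [← Λ.image_closure]; exact mem_image_of_mem _ hx
  obtain ⟨δ, hδ, hδ'⟩ := exists_forall_abs_timeChange_lt Φ Ψ Λ hη
    (isClosed_closure (s := T)).isCompact (fun x hx => hS.2.flow_ne hη (hmem x hx))
  have hcl : IsCrossSection Φ (closure T) δ := by
    rintro ⟨z, s⟩ ⟨hz, hs⟩ ⟨w, t⟩ ⟨hw, ht⟩ e
    obtain ⟨hm, hc, -, h0, hfl⟩ := hα z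
    obtain ⟨-, hc', -, h0', hfl'⟩ := hα w
    have e' : Ψ (α z s) (Λ z) = Ψ (α w t) (Λ w) := by
      rw [← hfl, ← hfl']
      exact congrArg Λ e
    obtain ⟨e1, e2⟩ := hS.2.eq_of_flow_eq (hmem z hz) (hmem w hw)
      (abs_le.1 (hδ' z hz _ ⟨hc, h0, hfl⟩ s (abs_le.2 hs)).le)
      (abs_le.1 (hδ' w hw _ ⟨hc', h0', hfl'⟩ t (abs_le.2 ht)).le) e'
    obtain rfl := Λ.injective e1
    rw [hm.injective e2]
  exact ⟨δ, hδ, hcl.mono subset_closure, hcl⟩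

end Reparametrization

section InvariantMeasures

/-- Over any time window, some orbit spends in `D` at least the proportion of time `ν D`. -/
lemma FlowInvariant.exists_le_volume [MeasurableSpace X] [BorelSpace X] [CompactSpace X]
    {Φ : Flow ℝ X} {ν : Measure X} [IsProbabilityMeasure ν] (hν : FlowInvariant Φ ν) {D : Set X}
    (hD : MeasurableSet D) (I : Set ℝ) (hI : volume I ≠ ⊤) (hIm : MeasurableSet I) :
    ∃ x, ν D * volume I ≤ volume {t ∈ I | Φ t x ∈ D} := by
  have hm : MeasurableSet {p : X × ℝ | p.2 ∈ I ∧ Φ p.2 p.1 ∈ D} := by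
    have hc : Continuous fun p : X × ℝ => Φ p.2 p.1 := by fun_prop
    exact (measurable_snd hIm).inter (hc.measurable hD)
  have : IsFiniteMeasure (volume.restrict I) := ⟨by simpa using hI.lt_top⟩
  have key : ∫⁻ x, volume {t ∈ I | Φ t x ∈ D} ∂ν = ν D * volume I := by
    have h1 := Measure.prod_apply (μ := ν) (ν := volume.restrict I) hm
    have h2 := Measure.prod_apply_symm (μ := ν) (ν := volume.restrict I) hm
    rw [h1] at h2
    have e1 : ∀ x, volume.restrict I (Prod.mk x ⁻¹' {p : X × ℝ | p.2 ∈ I ∧ Φ p.2 p.1 ∈ D})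
        = volume {t ∈ I | Φ t x ∈ D} := by
      intro x
      rw [Measure.restrict_apply (measurable_prodMk_left hm)]
      congr 1
      ext t
      simp +contextual
    have e2 : ∀ t ∈ I, ν ((fun x => (x, t)) ⁻¹' {p : X × ℝ | p.2 ∈ I ∧ Φ p.2 p.1 ∈ D})
        = ν D := by
      intro t ht
      conv_rhs => rw [← hν t, Measure.map_apply (Φ.continuous_toFun t).measurable hD]
      congr 1
      ext x
      simp [ht]
    simp_rw [e1] at h2
    rw [h2, setLIntegral_congr_fun hIm e2, setLIntegral_const]
  rw [← key]
  exact exists_lintegral_le (by rw [key]; exact ENNReal.mul_ne_top (measure_ne_top _ _) hI)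

/-- The normalized length of the orbit segment of `x` over `[a, b]`. -/
noncomputable def orbitMeasure [MeasurableSpace X] (Φ : Flow ℝ X) (x : X) (a b : ℝ) :
    Measure X :=
  (ProbabilityTheory.cond volume (Icc a b)).map fun t => Φ t x

lemma isProbabilityMeasure_orbitMeasure [MeasurableSpace X] [BorelSpace X] (Φ : Flow ℝ X)
    (x : X) {a b : ℝ} (hab : a < b) : IsProbabilityMeasure (orbitMeasure Φ x a b) := by
  have : IsProbabilityMeasure (ProbabilityTheory.cond volume (Icc a b)) :=
    ProbabilityTheory.cond_isProbabilityMeasure_of_finite (by simpa using hab) (by simp)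
  have hc : Continuous fun t => Φ t x := by fun_prop
  exact Measure.isProbabilityMeasure_map hc.measurable.aemeasurable

lemma orbitMeasure_apply [MeasurableSpace X] [BorelSpace X] (Φ : Flow ℝ X) (x : X) {a b : ℝ}
    {C : Set X} (hC : MeasurableSet C) :
    orbitMeasure Φ x a b C =
      (ENNReal.ofReal (b - a))⁻¹ * volume {t ∈ Icc a b | Φ t x ∈ C} := by
  have hc : Continuous fun t => Φ t x := by fun_prop
  rw [orbitMeasure, Measure.map_apply hc.measurable hC,
    ProbabilityTheory.cond_apply measurableSet_Icc, Real.volume_Icc]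
  rfl

lemma integral_orbitMeasure [MeasurableSpace X] [BorelSpace X] (Φ : Flow ℝ X) (x : X) {a b : ℝ}
    (hab : a < b) {g : X → ℝ} (hg : Continuous g) :
    ∫ z, g z ∂orbitMeasure Φ x a b = (b - a)⁻¹ * ∫ t in a..b, g (Φ t x) := by
  have hc : Continuous fun t => Φ t x := by fun_prop
  rw [orbitMeasure, integral_map hc.measurable.aemeasurable
    hg.measurable.aestronglyMeasurable, ProbabilityTheory.cond, integral_smul_measure,
    Real.volume_Icc, intervalIntegral.integral_of_le hab.le, integral_Icc_eq_integral_Ioc,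
    ENNReal.toReal_inv, ENNReal.toReal_ofReal (by linarith), smul_eq_mul]

lemma abs_integral_orbitMeasure_sub_le [MeasurableSpace X] [BorelSpace X] (Φ : Flow ℝ X) (x : X)
    {a b : ℝ} (hab : a < b) (f : BoundedContinuousFunction X ℝ) (s : ℝ) :
    |∫ z, f (Φ s z) ∂orbitMeasure Φ x a b - ∫ z, f z ∂orbitMeasure Φ x a b|
      ≤ 2 * ‖f‖ * |s| * (b - a)⁻¹ := by
  have hc : Continuous fun t => f (Φ t x) := by fun_prop
  have hint : ∀ u v, IntervalIntegrable (fun t => f (Φ t x)) volume u v :=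
    fun u v => hc.intervalIntegrable u v
  rw [integral_orbitMeasure Φ x hab (g := fun z => f (Φ s z)) (by fun_prop),
    integral_orbitMeasure Φ x hab f.continuous, ← mul_sub, abs_mul,
    abs_of_pos (inv_pos.2 (sub_pos.2 hab)), mul_comm]
  refine mul_le_mul_of_nonneg_right ?_ (inv_pos.2 (sub_pos.2 hab)).le
  have e : ∫ t in a..b, f (Φ s (Φ t x)) = ∫ t in (a + s)..(b + s), f (Φ t x) := by
    rw [← intervalIntegral.integral_comp_add_right (fun t => f (Φ t x)) s]
    simp_rw [add_comm _ s, Φ.map_add]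
  rw [e, intervalIntegral.integral_interval_sub_interval_comm' (hint _ _) (hint _ _) (hint _ _)]
  have hb : ∀ u v, |∫ t in u..v, f (Φ t x)| ≤ ‖f‖ * |v - u| := fun u v =>
    intervalIntegral.norm_integral_le_of_norm_le_const fun t _ => f.norm_coe_le_norm _
  have h1 := hb b (b + s)
  have h2 := hb a (a + s)
  rw [add_sub_cancel_left] at h1 h2
  rw [abs_le] at h1 h2 ⊢
  constructor <;> linarith

/-- Krylov–Bogoliubov: a closed set in which long orbit segments spend a definite proportion of
time is charged by some invariant probability measure. -/
lemma exists_flowInvariant_pos [MeasurableSpace X] [BorelSpace X] [CompactSpace X]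
    (Φ : Flow ℝ X) {C : Set X} (hC : IsClosed C) {ε : ℝ} (hε : 0 < ε)
    (h : ∀ n : ℕ, ∃ x a b, (n : ℝ) < b - a ∧
      ENNReal.ofReal (ε * (b - a)) ≤ volume {t ∈ Icc a b | Φ t x ∈ C}) :
    ∃ μ : Measure X, IsProbabilityMeasure μ ∧ FlowInvariant Φ μ ∧ μ C ≠ 0 := by
  choose x a b hab hvol using h
  have hpos : ∀ n, 0 < b n - a n := fun n => (Nat.cast_nonneg n).trans_lt (hab n)
  have hlt : ∀ n, a n < b n := fun n => sub_pos.1 (hpos n)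
  let μs : ℕ → ProbabilityMeasure X := fun n =>
    ⟨orbitMeasure Φ (x n) (a n) (b n), isProbabilityMeasure_orbitMeasure Φ _ (hlt n)⟩
  let U : Ultrafilter ℕ := Filter.hyperfilter ℕ
  have hU : (U : Filter ℕ) ≤ atTop := Nat.hyperfilter_le_atTop
  obtain ⟨μ, -, hμ⟩ := isCompact_univ.ultrafilter_le_nhds (U.map μs) (by simp)
  have hlim : Tendsto μs U (𝓝 μ) := hμ
  refine ⟨μ, inferInstance, fun s => ?_, ?_⟩
  · have hs := (Φ.continuous_toFun s).measurable
    have : IsProbabilityMeasure (Measure.map (Φ s) (μ : Measure X)) :=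
      Measure.isProbabilityMeasure_map hs.aemeasurable
    refine ext_of_forall_integral_eq_of_IsFiniteMeasure fun f => ?_
    rw [integral_map hs.aemeasurable f.continuous.measurable.aestronglyMeasurable]
    have hl := ProbabilityMeasure.tendsto_iff_forall_integral_tendsto.1 hlim
    have h1 := hl (f.compContinuous ⟨_, Φ.continuous_toFun s⟩)
    have h2 := h1.sub (hl f)
    have hinv : Tendsto (fun n => (b n - a n)⁻¹) U (𝓝 0) :=
      (tendsto_inv_atTop_zero.comp (tendsto_atTop_mono (fun n => (hab n).le)
        tendsto_natCast_atTop_atTop)).mono_left hU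
    have h3 : Tendsto (fun n => 2 * ‖f‖ * |s| * (b n - a n)⁻¹) U (𝓝 0) := by
      simpa using hinv.const_mul (2 * ‖f‖ * |s|)
    have h4 := squeeze_zero_norm (fun n => (Real.norm_eq_abs _).trans_le <|
      abs_integral_orbitMeasure_sub_le Φ (x n) (hlt n) f s) h3
    exact sub_eq_zero.1 (tendsto_nhds_unique h2 h4)
  · have h1 := ProbabilityMeasure.limsup_measure_closed_le_of_tendsto hlim hC
    have h2 : ∀ n, ENNReal.ofReal ε ≤ (μs n : Measure X) C := by
      intro n
      change _ ≤ orbitMeasure Φ (x n) (a n) (b n) C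
      rw [orbitMeasure_apply Φ _ hC.measurableSet, mul_comm, ← div_eq_mul_inv,
        ENNReal.le_div_iff_mul_le (Or.inl (by simpa using hlt n)) (Or.inl (by simp)),
        ← ENNReal.ofReal_mul hε.le]
      exact hvol n
    have h3 : ENNReal.ofReal ε ≤ limsup (fun n => (μs n : Measure X) C) U :=
      le_limsup_of_frequently_le (Frequently.of_forall h2)
    exact ((ENNReal.ofReal_pos.2 hε).trans_le (h3.trans h1)).ne'

end InvariantMeasures

section Visits

lemma IsCrossSection.card_visits_mul_le {Φ : Flow ℝ X} {B : Set X} {η : ℝ}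
    (hB : IsCrossSection Φ B η) (x : X) {a b : ℝ} {F : Finset ℝ}
    (hF : ∀ v ∈ F, v ∈ Icc a b ∧ Φ v x ∈ B) :
    F.card * ENNReal.ofReal (2 * η) ≤
      volume {t ∈ Icc (a - η) (b + η) | Φ t x ∈ cyl Φ B η} := by
  have e : ∑ v ∈ F, volume (Icc (v - η) (v + η)) = F.card * ENNReal.ofReal (2 * η) := by
    simp only [Real.volume_Icc]
    rw [Finset.sum_congr rfl (fun v _ => by
      rw [show v + η - (v - η) = 2 * η by ring]), Finset.sum_const, nsmul_eq_mul]
  rw [← e, ← measure_biUnion_finset]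
  · refine measure_mono (iUnion₂_subset fun v hv t ht => ?_)
    obtain ⟨hvab, hvB⟩ := hF v hv
    refine ⟨⟨by linarith [hvab.1, ht.1], by linarith [hvab.2, ht.2]⟩,
      mem_cyl.2 ⟨t - v, ⟨by linarith [ht.1], by linarith [ht.2]⟩, _, hvB, ?_⟩⟩
    rw [← Φ.map_add, sub_add_cancel]
  · intro u hu v hv huv
    refine Set.disjoint_left.2 fun t ht ht' => huv ?_
    refine hB.visit_unique (hF u hu).2 (hF v hv).2 (abs_le.2 ?_)
    exact ⟨by linarith [ht.1, ht.2, ht'.1, ht'.2], by linarith [ht.1, ht.2, ht'.1, ht'.2]⟩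
  · exact fun v _ => measurableSet_Icc

lemma IsCrossSection.finite_visits {Φ : Flow ℝ X} {B : Set X} {η : ℝ} (hη : 0 < η)
    (hB : IsCrossSection Φ B η) (x : X) (a b : ℝ) : {v ∈ Icc a b | Φ v x ∈ B}.Finite := by
  by_contra hinf
  obtain ⟨n, hn⟩ := exists_nat_gt ((b + η - (a - η)) / (2 * η))
  obtain ⟨F, hF, rfl⟩ := Set.Infinite.exists_subset_card_eq hinf n
  have h := (hB.card_visits_mul_le x (fun v hv => hF hv)).trans
    (measure_mono (sep_subset _ _))
  rw [Real.volume_Icc, ← ENNReal.ofReal_natCast, ← ENNReal.ofReal_mul (Nat.cast_nonneg _)] at h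
  have hp : 0 < (F.card : ℝ) * (2 * η) := by
    rcases Nat.eq_zero_or_pos F.card with h0 | h0
    · obtain ⟨v, hv⟩ := Set.Infinite.nonempty hinf
      rw [h0, Nat.cast_zero, div_lt_iff₀ (by linarith)] at hn
      linarith [hv.1.1, hv.1.2]
    · positivity
  rw [div_lt_iff₀ (by linarith)] at hn
  rw [ENNReal.ofReal_le_ofReal_iff'] at h
  rcases h with h | h <;> linarith

lemma volume_cyl_le_card_visits {Φ : Flow ℝ X} {B : Set X} {η : ℝ} (x : X) {a b : ℝ}
    {F : Finset ℝ} (hF : ∀ v ∈ Icc (a - η) (b + η), Φ v x ∈ B → v ∈ F) :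
    volume {t ∈ Icc a b | Φ t x ∈ cyl Φ B η} ≤ F.card * ENNReal.ofReal (2 * η) := by
  have e : ∑ v ∈ F, volume (Icc (v - η) (v + η)) = F.card * ENNReal.ofReal (2 * η) := by
    simp only [Real.volume_Icc]
    rw [Finset.sum_congr rfl (fun v _ => by
      rw [show v + η - (v - η) = 2 * η by ring]), Finset.sum_const, nsmul_eq_mul]
  rw [← e]
  refine (measure_mono ?_).trans (measure_biUnion_finset_le F _)
  rintro t ⟨ht, hc⟩
  obtain ⟨s, hs, z, hz, e⟩ := mem_cyl.1 hc
  have hz' : Φ (t - s) x = z := by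
    rw [sub_eq_neg_add, Φ.map_add, ← e, ← Φ.map_add, neg_add_cancel, Φ.map_zero_apply]
  refine mem_iUnion₂.2 ⟨t - s, hF _ ⟨by linarith [ht.1, hs.2], by linarith [ht.2, hs.1]⟩
    (hz' ▸ hz), ?_⟩
  exact ⟨by linarith [hs.1, hs.2], by linarith [hs.1, hs.2]⟩

end Visits

section Nullity

variable {Y : Type*} [MetricSpace Y]

/-- Orbit equivalences preserve nullity of cylinders over closed cross-sections. -/
lemma OrbitEquivalence.cyl_null [CompactSpace X] [MeasurableSpace X] [BorelSpace X]
    [CompactSpace Y] [MeasurableSpace Y] [BorelSpace Y]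
    {Φ : Flow ℝ X} {Ψ : Flow ℝ Y} (hΦ : Regular Φ) {Λ : X ≃ₜ Y} (h : OrbitEquivalence Φ Ψ Λ)
    {B : Set X} (hBc : IsClosed B) {η' η : ℝ} (hη' : 0 < η') (hη : 0 < η)
    (hB : IsCrossSection Φ B η') (hB' : IsCrossSection Ψ (Λ '' B) η)
    (hnull : ∀ μ : Measure X, IsProbabilityMeasure μ → FlowInvariant Φ μ →
      μ (cyl Φ B η') = 0)
    (ν : Measure Y) [IsProbabilityMeasure ν] (hν : FlowInvariant Ψ ν) :
    ν (cyl Ψ (Λ '' B) η) = 0 := by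
  by_contra hne
  have hC : IsClosed (cyl Φ B η') := (isCompact_flowSet Φ isCompact_Icc hBc.isCompact).isClosed
  have hC' : IsClosed (cyl Ψ (Λ '' B) η) :=
    (isCompact_flowSet Ψ isCompact_Icc (hBc.isCompact.image Λ.continuous)).isClosed
  obtain ⟨β, hβ⟩ := h.symm
  obtain ⟨δ, hδ, K, hK, hlin⟩ := hΦ.exists_forall_abs_timeChange_lt Ψ Λ.symm
  set p := (ν (cyl Ψ (Λ '' B) η)).toReal with hp_def
  have hp : 0 < p := ENNReal.toReal_pos hne (measure_ne_top _ _)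
  set M := K * ((1 + 2 * η) / δ + 1) + 2 * η' with hM_def
  have hM : 0 < M := by positivity
  have hε : 0 < η' * p / (η * M) := by positivity
  obtain ⟨μ, hμ, hinv, hpos⟩ := exists_flowInvariant_pos Φ hC hε fun n => by
    obtain ⟨L, hL1, hLn⟩ : ∃ L : ℝ, 1 ≤ L ∧ n < η' * p / η * L := by
      refine ⟨max 1 ((n + 1) / (η' * p / η)), le_max_left _ _, ?_⟩
      have : (n + 1 : ℝ) ≤ η' * p / η * max 1 ((n + 1) / (η' * p / η)) := by
        rw [mul_comm, ← div_le_iff₀ (by positivity)]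
        exact le_max_right _ _
      linarith
    obtain ⟨y, hy⟩ := hν.exists_le_volume hC'.measurableSet (Icc 0 L) (by simp)
      measurableSet_Icc
    obtain ⟨hm, hc, -, h0, hfl⟩ := hβ y
    have hfin := hB'.finite_visits hη y (0 - η) (L + η)
    have hup := hy.trans (volume_cyl_le_card_visits (F := hfin.toFinset) y
      (fun v hv hvB => hfin.mem_toFinset.2 ⟨hv, hvB⟩))
    have hlow := hB.card_visits_mul_le (Λ.symm y) (a := β y (0 - η)) (b := β y (L + η))
      (F := hfin.toFinset.image (β y)) (by
        intro u hu
        simp only [Finset.mem_image, Finite.mem_toFinset] at hu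
        obtain ⟨v, ⟨hv, z, hz, hzv⟩, rfl⟩ := hu
        refine ⟨⟨hm.monotone hv.1, hm.monotone hv.2⟩, ?_⟩
        rw [← hfl, ← hzv, Λ.symm_apply_apply]
        exact hz)
    rw [Finset.card_image_of_injective _ hm.injective] at hlow
    set N := hfin.toFinset.card
    have hup' : p * L ≤ N * (2 * η) := by
      rw [Real.volume_Icc, ← ENNReal.ofReal_toReal (measure_ne_top ν _),
        ← ENNReal.ofReal_mul hp.le, ← ENNReal.ofReal_natCast,
        ← ENNReal.ofReal_mul (Nat.cast_nonneg _), sub_zero,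
        ENNReal.ofReal_le_ofReal_iff (by positivity)] at hup
      exact hup
    have hlen : β y (L + η) - β y (0 - η) + 2 * η' ≤ M * L := by
      have := IsTimeChange.sub_le ⟨hc, h0, hfl⟩ hm.monotone hδ hK hlin
        (a := 0 - η) (b := L + η) (by linarith)
      have e1 : (L + η - (0 - η)) / δ + 1 ≤ ((1 + 2 * η) / δ + 1) * L := by
        have : (L + η - (0 - η)) / δ ≤ (1 + 2 * η) / δ * L := by
          rw [div_mul_eq_mul_div]
          gcongr
          nlinarith
        linarith
      have e2 := mul_le_mul_of_nonneg_left e1 hK.le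
      rw [hM_def]
      nlinarith
    have hN : η' * p / η * L ≤ N * (2 * η') := by
      have : η' / η * (p * L) ≤ η' / η * (N * (2 * η)) := by gcongr
      calc η' * p / η * L = η' / η * (p * L) := by ring
        _ ≤ _ := this
        _ = _ := by field_simp
    rw [← ENNReal.ofReal_natCast, ← ENNReal.ofReal_mul (Nat.cast_nonneg _)] at hlow
    have hmono : β y (0 - η) ≤ β y (L + η) := hm.monotone (by linarith)
    refine ⟨Λ.symm y, _, _, ?_, (ENNReal.ofReal_le_ofReal ?_).trans hlow⟩
    · have h2 := hlow.trans (measure_mono (sep_subset _ _))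
      rw [Real.volume_Icc, ENNReal.ofReal_le_ofReal_iff (by linarith)] at h2
      linarith
    · calc _ ≤ η' * p / (η * M) * (M * L) := by
            gcongr
            linarith
        _ = η' * p / η * L := by field_simp
        _ ≤ _ := hN
  exact hpos (hnull μ hμ hinv)

end Nullity

/-- the small flow boundary property is preserved by orbit equivalence of regular
topological flows. -/
theorem smallFlowBoundaryProperty_orbitEquivalence
    {X Y : Type*} [MetricSpace X] [CompactSpace X] [MeasurableSpace X] [BorelSpace X]
    [MetricSpace Y] [CompactSpace Y] [MeasurableSpace Y] [BorelSpace Y]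
    (Φ : Flow ℝ X) (Ψ : Flow ℝ Y) (hΦ : Regular Φ) (hΨ : Regular Ψ)
    (Λ : X ≃ₜ Y) (heq : OrbitEquivalence Φ Ψ Λ)
    (h : SmallFlowBoundaryProperty Φ) :
    SmallFlowBoundaryProperty Ψ := by
  intro y S' η hη hS' hy
  obtain ⟨T', rfl⟩ : ∃ T', Λ '' T' = S' := ⟨Λ.symm '' S', Λ.image_symm_image S'⟩
  obtain ⟨η', hη', hT'⟩ := heq.exists_isWec hη hS'
  rw [← image_flowInterior heq hη' hη hT' hS'] at hy
  obtain ⟨x, hx, rfl⟩ := hy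
  obtain ⟨T, hTT', hxT, hT, hsmall⟩ := h x T' η' hη' hT' hx
  have hsub : Λ '' T ⊆ Λ '' T' := image_mono hTT'
  have hS : IsWec Ψ (Λ '' T) η := ⟨hS'.1.mono hsub, hS'.2.mono (closure_mono hsub)⟩
  have hint := image_flowInterior heq hη' hη hT hS
  have hbd : Λ '' flowBoundary Φ T η' = flowBoundary Ψ (Λ '' T) η := by
    rw [flowBoundary, flowBoundary, image_sdiff Λ.injective, Λ.image_closure, hint]
  refine ⟨Λ '' T, hsub, hint ▸ mem_image_of_mem _ hxT, hS, fun ν _ hν => ?_⟩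
  rw [flowBoundaryCyl, ← hbd]
  refine heq.cyl_null hΦ (hT.isClosed_flowBoundary hη') hη' hη (hT.2.mono sdiff_subset) ?_
    hsmall ν hν
  rw [hbd]
  exact hS.2.mono sdiff_subset

end FlowPaper
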